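/- Let α, β be nonzero real algebraic numbers with |α|, |β| ≠ 1 such that log|α| and log|β| are linearly independent over ℚ. Then the ratio log|α| / log|β| is transcendental. -/

import Mathlib

namespace GS
open Finset

/-- Rolle: `n+1` zeros of `f` give `n` zeros of `f'`. -/
lemma rolle_finset (f f' : ℝ → ℝ) (hf : ∀ x, HasDerivAt f (f' x) x) (n : ℕ) (Z : Finset ℝ)
    (hZ : Z.card = n + 1) (h0 : ∀ z ∈ Z, f z = 0) :
    ∃ Z' : Finset ℝ, Z'.card = n ∧ ∀ z ∈ Z', f' z = 0 := by
  let e := Z.orderEmbOfFin hZ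
  have key : ∀ k : Fin n, ∃ x ∈ Set.Ioo (e k.castSucc) (e k.succ), f' x = 0 := by
    intro k
    apply exists_hasDerivAt_eq_zero (f := f)
    · exact e.strictMono Fin.castSucc_lt_succ
    · exact fun x _ => (hf x).continuousAt.continuousWithinAt
    · rw [h0 _ (Z.orderEmbOfFin_mem hZ _), h0 _ (Z.orderEmbOfFin_mem hZ _)]
    · exact fun x _ => hf x
  choose x hx hx0 using key
  have hmono : StrictMono x := by
    intro i j hij
    calc x i < e i.succ := (hx i).2
      _ ≤ e j.castSucc := e.monotone (by
          rw [Fin.le_def]; simp only [Fin.val_succ, Fin.val_castSucc]; exact hij)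
      _ < x j := (hx j).1
  refine ⟨univ.image x, ?_, ?_⟩
  · rw [card_image_of_injective _ hmono.injective]; simp
  · intro z hz
    simp only [mem_image, mem_univ, true_and] at hz
    obtain ⟨k, rfl⟩ := hz
    exact hx0 k

open Polynomial in
/-- Zero estimate for real exponential polynomials. -/
lemma zero_estimate {J : Type*} [DecidableEq J] (s : Finset J) (e : J → ℝ)
    (he : Function.Injective e) (n : ℕ) : ∀ (P : J → ℝ[X]) (d : J → ℕ) (Z : Finset ℝ),
    (∑ w ∈ s, d w = n) → (∀ w ∈ s, (P w).degree < d w) → Z.card = n →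
    (∀ z ∈ Z, ∑ w ∈ s, (P w).eval z * Real.exp (e w * z) = 0) → ∀ w ∈ s, P w = 0 := by
  induction n with
  | zero =>
    intro P d Z hd hP _ _ w hw
    have h := hP w hw
    rw [(Finset.sum_eq_zero_iff.1 hd) w hw] at h
    simpa using h
  | succ n ih =>
    intro P d Z hd hP hZ h0
    obtain ⟨w0, hw0, hdw0⟩ : ∃ w0 ∈ s, d w0 ≠ 0 := by
      by_contra! h
      rw [Finset.sum_eq_zero h] at hd
      omega
    obtain ⟨Z', hZ', h0'⟩ := rolle_finset
      (fun z => ∑ w ∈ s, (P w).eval z * Real.exp ((e w - e w0) * z))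
      (fun z => ∑ w ∈ s, (derivative (P w) + C (e w - e w0) * P w).eval z * Real.exp ((e w - e w0) * z))
      (by
        intro x
        apply HasDerivAt.fun_sum
        intro w _
        have h1 := (P w).hasDerivAt x
        have h2 : HasDerivAt (fun z => Real.exp ((e w - e w0) * z))
            (Real.exp ((e w - e w0) * x) * ((e w - e w0) * 1)) x :=
          ((hasDerivAt_id x).const_mul (e w - e w0)).exp
        refine (h1.mul h2).congr_deriv ?_
        simp only [eval_add, eval_mul, eval_C]
        ring) n Z hZ (by
        intro z hz
        have := h0 z hz
        have h3 : ∀ w, Real.exp ((e w - e w0) * z) = Real.exp (e w * z) * Real.exp (-(e w0 * z)) := by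
          intro w; rw [← Real.exp_add]; ring_nf
        simp only [h3, ← mul_assoc, ← Finset.sum_mul, this, zero_mul])
    have hres := ih (fun w => derivative (P w) + C (e w - e w0) * P w)
      (Function.update d w0 (d w0 - 1)) Z' (by
        rw [Finset.sum_update_of_mem hw0]
        have := Finset.add_sum_erase s d hw0
        rw [Finset.sdiff_singleton_eq_erase]
        omega) (by
        intro w hw
        by_cases h : w = w0
        · subst h
          simp only [sub_self, map_zero, zero_mul, add_zero, Function.update_self]
          by_cases hz : P w = 0
          · simp [hz]
          have h1 := degree_derivative_lt hz
          have h2 := hP w hw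
          by_cases hz' : derivative (P w) = 0
          · simp [hz']
          rw [degree_eq_natDegree hz] at h1 h2
          rw [degree_eq_natDegree hz'] at h1 ⊢
          norm_cast at *
          omega
        · rw [Function.update_of_ne h]
          refine lt_of_le_of_lt (degree_add_le _ _) (max_lt ?_ ?_)
          · exact lt_of_le_of_lt (degree_derivative_le) (hP w hw)
          · refine lt_of_le_of_lt ?_ (hP w hw)
            rw [degree_C_mul (sub_ne_zero.2 (he.ne h))]) hZ' (by
        intro z hz
        have := h0' z hz
        have h3 : ∀ w, Real.exp (e w * z) = Real.exp ((e w - e w0) * z) * Real.exp ((e w0 * z)) := by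
          intro w; rw [← Real.exp_add]; ring_nf
        rw [Finset.sum_congr rfl (fun w _ => by rw [h3 w, ← mul_assoc]), ← Finset.sum_mul,
          this, zero_mul])
    have hne : ∀ w ∈ s, w ≠ w0 → P w = 0 := by
      intro w hw h
      by_contra hz
      have h1 := hres w hw
      have h2 := degree_derivative_lt hz
      have h3 : derivative (P w) = - (C (e w - e w0) * P w) := eq_neg_of_add_eq_zero_left h1
      rw [h3, degree_neg, degree_C_mul (sub_ne_zero.2 (he.ne h))] at h2
      exact lt_irrefl _ h2
    intro w hw
    by_cases h : w = w0
    · subst h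
      have h1 := hres w hw
      simp only [sub_self, map_zero, zero_mul, add_zero] at h1
      obtain ⟨z, hz⟩ : Z.Nonempty := by
        rw [← Finset.card_pos]; omega
      have h2 := h0 z hz
      rw [Finset.sum_eq_single w (fun v hv hvw => by simp [hne v hv hvw]) (fun h => absurd hw h)]
        at h2
      have h3 := eq_C_of_derivative_eq_zero h1
      rw [h3] at h2 ⊢
      simpa [Real.exp_ne_zero] using h2
    · exact hne w hw h

/-- iterated divided differences -/
noncomputable def dd (f : ℂ → ℂ) (ζ : ℕ → ℂ) : ℕ → ℂ → ℂ
  | 0 => f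
  | k + 1 => dslope (dd f ζ k) (ζ k)

lemma dd_diff (f : ℂ → ℂ) (hf : Differentiable ℂ f) (ζ : ℕ → ℂ) (k : ℕ) :
    Differentiable ℂ (dd f ζ k) := by
  induction k with
  | zero => exact hf
  | succ k ih =>
    rw [← differentiableOn_univ] at ih ⊢
    exact (Complex.differentiableOn_dslope Filter.univ_mem).2 ih

lemma newton (f : ℂ → ℂ) (ζ : ℕ → ℂ) (z : ℂ) (n : ℕ) :
    f z = ∑ k ∈ range n, dd f ζ k (ζ k) * ∏ l ∈ range k, (z - ζ l)
      + dd f ζ n z * ∏ l ∈ range n, (z - ζ l) := by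
  induction n with
  | zero => simp [dd]
  | succ n ih =>
    rw [ih, sum_range_succ, prod_range_succ]
    have := sub_smul_dslope (dd f ζ n) (ζ n) z
    simp only [smul_eq_mul] at this
    have h2 : dd f ζ n z = dd f ζ n (ζ n) + (z - ζ n) * dd f ζ (n+1) z := by
      rw [dd, this]; ring
    rw [h2]; ring

lemma dd_bound (f : ℂ → ℂ) (hf : Differentiable ℂ f) (ζ : ℕ → ℂ) (r B : ℝ) (hr : 0 < r)
    (hζ : ∀ k, ‖ζ k‖ ≤ r) (hB : ∀ z, ‖z‖ ≤ 13 * r → ‖f z‖ ≤ B) (k : ℕ) :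
    ∀ z, ‖z‖ ≤ 13 * r → ‖dd f ζ k z‖ ≤ (1 / (6 * r)) ^ k * B := by
  induction k with
  | zero => simpa [dd] using hB
  | succ k ih =>
    intro z hz
    have hB0 : 0 ≤ (1 / (6 * r)) ^ k * B := (norm_nonneg _).trans (ih 0 (by simp; positivity))
    apply Complex.norm_le_of_forall_mem_frontier_norm_le (U := Metric.ball 0 (13 * r))
      Metric.isBounded_ball ((dd_diff f hf ζ (k+1)).diffContOnCl)
    · intro y hy
      rw [frontier_ball _ (by positivity), mem_sphere_zero_iff_norm] at hy
      have hne : y ≠ ζ k := by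
        rintro rfl
        have := hζ k
        linarith
      rw [dd, dslope_of_ne _ hne, slope_def_field, norm_div]
      have h1 : 12 * r ≤ ‖y - ζ k‖ := by
        have := norm_sub_norm_le y (ζ k)
        have := hζ k
        linarith
      have h2 : ‖dd f ζ k y - dd f ζ k (ζ k)‖ ≤ 2 * ((1 / (6 * r)) ^ k * B) := by
        refine (norm_sub_le _ _).trans ?_
        have := ih y hy.le
        have := ih (ζ k) ((hζ k).trans (by linarith))
        linarith
      calc _ ≤ 2 * ((1 / (6 * r)) ^ k * B) / (12 * r) := by gcongr
        _ = _ := by rw [pow_succ]; field_simp; ring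
    · rw [closure_ball _ (by positivity)]
      simpa using hz

lemma norm_det_le_prod {L : ℕ} (G : Matrix (Fin L) (Fin L) ℂ) (c : Fin L → ℝ)
    (h : ∀ i l, ‖G i l‖ ≤ c l) : ‖G.det‖ ≤ L.factorial * ∏ l, c l := by
  rw [Matrix.det_apply]
  refine (norm_sum_le _ _).trans ?_
  calc _ ≤ ∑ σ : Equiv.Perm (Fin L), ∏ l, c l := by
        apply Finset.sum_le_sum
        intro σ _
        have : ‖Equiv.Perm.sign σ • ∏ i, G (σ i) i‖ = ‖∏ i, G (σ i) i‖ := by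
          rcases Int.units_eq_one_or (Equiv.Perm.sign σ) with h | h <;> simp [h]
        rw [this, norm_prod]
        exact Finset.prod_le_prod (fun _ _ => norm_nonneg _) (fun i _ => h _ _)
    _ = _ := by simp [Finset.card_univ, Fintype.card_perm]

/-- Upper bound for interpolation determinants. -/
lemma det_upper {L : ℕ} (f : Fin L → ℂ → ℂ) (hf : ∀ i, Differentiable ℂ (f i)) (ζ : ℕ → ℂ)
    (r B : ℝ) (hr : 0 < r) (hζ : ∀ k, ‖ζ k‖ ≤ r)
    (hB : ∀ i z, ‖z‖ ≤ 13 * r → ‖f i z‖ ≤ B) :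
    ‖(Matrix.of fun i k : Fin L => f i (ζ k)).det‖ ≤
      L.factorial * (B ^ L * (1 / 3) ^ (∑ l ∈ range L, l)) := by
  let G : Matrix (Fin L) (Fin L) ℂ := Matrix.of fun i l => dd (f i) ζ l (ζ l)
  let U : Matrix (Fin L) (Fin L) ℂ := Matrix.of fun l k => ∏ m ∈ range l, (ζ k - ζ m)
  have hU0 : ∀ l k : ℕ, k < l → ∏ m ∈ range l, (ζ k - ζ m) = 0 := by
    intro l k h
    exact Finset.prod_eq_zero (mem_range.2 h) (sub_self _)
  have hA : (Matrix.of fun i k : Fin L => f i (ζ k)) = G * U := by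
    ext i k
    rw [Matrix.mul_apply]
    simp only [Matrix.of_apply, G, U]
    rw [newton (f i) ζ (ζ k) L, hU0 L k k.2, mul_zero, add_zero, Finset.sum_range]
  have hUd : U.det = ∏ l, U l l := by
    apply Matrix.det_of_isUpperTriangular
    intro l k h
    exact hU0 l k h
  have hUb : ‖U.det‖ ≤ ∏ l : Fin L, (2 * r) ^ (l : ℕ) := by
    rw [hUd, norm_prod]
    apply Finset.prod_le_prod (fun _ _ => norm_nonneg _)
    intro l _
    simp only [U, Matrix.of_apply, norm_prod]
    calc _ ≤ ∏ m ∈ range (l : ℕ), (2 * r) := by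
          apply Finset.prod_le_prod (fun _ _ => norm_nonneg _)
          intro m _
          refine (norm_sub_le _ _).trans ?_
          have := hζ l
          have := hζ m
          linarith
      _ = _ := by simp
  have hGb : ‖G.det‖ ≤ L.factorial * ∏ l : Fin L, ((1 / (6 * r)) ^ (l : ℕ) * B) := by
    apply norm_det_le_prod
    intro i l
    exact dd_bound (f i) (hf i) ζ r B hr hζ (hB i) l _ ((hζ l).trans (by linarith))
  rw [hA, Matrix.det_mul, norm_mul]
  calc _ ≤ (L.factorial * ∏ l : Fin L, ((1 / (6 * r)) ^ (l : ℕ) * B)) *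
        ∏ l : Fin L, (2 * r) ^ (l : ℕ) := by
        gcongr
        exact (norm_nonneg _).trans hGb
    _ = L.factorial * ∏ l : Fin L, (B * (1 / 3) ^ (l : ℕ)) := by
        rw [mul_assoc, ← Finset.prod_mul_distrib]
        congr 1
        apply Finset.prod_congr rfl
        intro l _
        rw [mul_right_comm, ← mul_pow, mul_comm]
        congr 2
        field_simp
        norm_num
    _ = _ := by
        rw [Finset.prod_mul_distrib, Finset.prod_pow_eq_pow_sum, Finset.sum_range]
        simp

/-- Liouville lower bound. -/
lemma liouville {K : Type*} [Field K] [NumberField K] (σ : K →+* ℂ) {L : ℕ}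
    (M : Matrix (Fin L) (Fin L) K) (hint : ∀ i j, IsIntegral ℤ (M i j)) (hdet : M.det ≠ 0)
    (H : ℝ) (hH : ∀ (τ : K →+* ℂ) i j, ‖τ (M i j)‖ ≤ H) :
    1 ≤ ‖σ M.det‖ * (L.factorial * H ^ L) ^ (Module.finrank ℚ K - 1) := by
  have hi : IsIntegral ℤ M.det := IsIntegral.det hint
  have h1 : (1 : ℝ) ≤ ‖Algebra.norm ℚ M.det‖ := by
    have h2 : IsIntegral ℤ (Algebra.norm ℚ M.det) := Algebra.isIntegral_norm ℚ hi
    obtain ⟨z, hz⟩ := IsIntegrallyClosed.isIntegral_iff.1 h2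
    have hz0 : z ≠ 0 := by
      rintro rfl
      rw [map_zero] at hz
      exact hdet (Algebra.norm_eq_zero_iff.1 hz.symm)
    rw [← hz]
    simp only [algebraMap_int_eq, eq_intCast]
    rw [← Rat.norm_cast_real]
    simp only [Rat.cast_intCast, Real.norm_eq_abs]
    exact_mod_cast Int.one_le_abs hz0
  refine h1.trans ((NumberField.norm_norm_le_norm_mul_house_pow M.det σ).trans ?_)
  gcongr
  · exact NumberField.house_nonneg _
  · rw [NumberField.house, pi_norm_le_iff_of_nonempty]
    intro τ
    rw [NumberField.canonicalEmbedding.apply_at, RingHom.map_det]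
    refine (norm_det_le_prod _ (fun _ => H) ?_).trans (by simp)
    intro i j
    exact hH τ i j

open Polynomial in
lemma nonvanish {D1 D2 L : ℕ} (w : Fin D2 → ℝ) (hw : Function.Injective w) (x : Fin L → ℝ)
    (hx : Function.Injective x) (e : Fin L ≃ Fin D1 × Fin D2) :
    (Matrix.of fun i k : Fin L => x k ^ ((e i).1 : ℕ) * Real.exp (w (e i).2 * x k)).det ≠ 0 := by
  intro hdet
  obtain ⟨v, hv0, hv⟩ := Matrix.exists_vecMul_eq_zero_iff.2 hdet
  have hcard : D2 * D1 = L := by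
    have := Fintype.card_congr e
    simp at this
    rw [this, mul_comm]
  let P : Fin D2 → ℝ[X] := fun j => ∑ i : Fin D1, C (v (e.symm (i, j))) * X ^ (i : ℕ)
  have hP := zero_estimate Finset.univ w hw L P (fun _ => D1) (univ.image x) (by simp [hcard])
    (by
      intro j _
      exact degree_sum_fin_lt _)
    (by rw [card_image_of_injective _ hx]; simp)
    (by
      intro z hz
      simp only [mem_image, mem_univ, true_and] at hz
      obtain ⟨k, rfl⟩ := hz
      have h1 := congrFun hv k
      simp only [Matrix.vecMul, dotProduct, Matrix.of_apply, Pi.zero_apply] at h1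
      rw [← e.symm.sum_comp] at h1
      rw [← h1, Fintype.sum_prod_type_right]
      apply Finset.sum_congr rfl
      intro j _
      simp only [P, eval_finsetSum, eval_mul, eval_C, eval_pow, eval_X, Finset.sum_mul,
        Equiv.apply_symm_apply, mul_assoc])
  apply hv0
  funext l
  have h2 := hP (e l).2 (mem_univ _)
  have h3 := congrArg (fun p => p.coeff (e l).1) h2
  simp only [P, finsetSum_coeff, coeff_C_mul, coeff_X_pow, coeff_zero] at h3
  rw [Finset.sum_eq_single (e l).1] at h3
  · simpa using h3
  · intro b _ hb
    have : ((e l).1 : ℕ) ≠ b := fun h => hb (Fin.ext h.symm)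
    simp [this]
  · simp

lemma numeric (C : ℝ) (hC : 1 ≤ C) (d : ℕ) (h : ∀ N : ℕ, 2 ≤ N →
    (3 : ℝ) ^ (∑ l ∈ range (N ^ 4), l) ≤ (((C * N ^ 2) ^ (2 * N ^ 3)) ^ (N ^ 4)) ^ d) : False := by
  obtain ⟨m, hm⟩ := exists_nat_gt (32 * d * C + 2)
  have hm2 : (2 : ℝ) < m := lt_of_le_of_lt (by have : 0 ≤ 32 * (d : ℝ) * C := by positivity
                                               linarith) hm
  have hm2' : 2 < m := by exact_mod_cast hm2
  have h1 := h (m ^ 2) (by nlinarith)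
  have h2 := pow_le_pow_left₀ (by positivity) h1 2
  rw [← pow_mul, Finset.sum_range_id_mul_two] at h2
  have h3 := Real.log_le_log (by positivity) h2
  simp only [Real.log_pow] at h3
  have hlog3 : 1 ≤ Real.log 3 := by
    rw [Real.le_log_iff_exp_le (by norm_num)]
    linarith [Real.exp_one_lt_d9]
  have hlogQ : Real.log (C * ((m ^ 2 : ℕ) : ℝ) ^ 2) ≤ 4 * (C * m) := by
    calc _ ≤ Real.log ((C * m) ^ 4) := by
            apply Real.log_le_log (by positivity)
            push_cast
            have : C ≤ C ^ 4 := le_self_pow₀ hC (by norm_num)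
            calc _ = C * (m : ℝ) ^ 4 := by ring
              _ ≤ C ^ 4 * (m : ℝ) ^ 4 := by gcongr
              _ = _ := by ring
      _ = 4 * Real.log (C * m) := by rw [Real.log_pow]; norm_num
      _ ≤ _ := by
        have := Real.log_le_self (x := C * m) (by positivity)
        linarith
  push_cast at hlogQ
  obtain ⟨M, hM⟩ : ∃ M : ℝ, M = (m : ℝ) := ⟨_, rfl⟩
  rw [← hM] at hm hm2 hlogQ
  have hNL : (((m ^ 2) ^ 4 - 1 : ℕ) : ℝ) = M ^ 8 - 1 := by
    rw [Nat.cast_sub (Nat.one_le_pow _ _ (by positivity))]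
    push_cast; rw [← hM]; ring
  push_cast [hNL] at h3
  rw [← hM] at h3
  have hM8 : M ^ 8 / 2 ≤ M ^ 8 - 1 := by
    have : (2 : ℝ) ^ 8 ≤ M ^ 8 := by gcongr
    linarith
  have h4 : (M ^ 2) ^ 4 * (M ^ 8 / 2) * 1 ≤ (M ^ 2) ^ 4 * (M ^ 8 - 1) * Real.log 3 := by
    have : 0 ≤ M ^ 8 - 1 := le_trans (by positivity) hM8
    gcongr
  have h5 := h4.trans h3
  have h6 : 2 * (d * ((M ^ 2) ^ 4 * (2 * (M ^ 2) ^ 3 * Real.log (C * (M ^ 2) ^ 2)))) ≤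
      2 * (d * ((M ^ 2) ^ 4 * (2 * (M ^ 2) ^ 3 * (4 * (C * M))))) := by gcongr
  have h7 := h5.trans h6
  have h8 : M ^ 15 * M ≤ M ^ 15 * (32 * d * C) := by nlinarith
  have h9 := le_of_mul_le_mul_left h8 (by positivity)
  linarith


lemma exists_den {K : Type*} [Field K] [NumberField K] (a b c : K) :
    ∃ q : ℤ, q ≠ 0 ∧ IsIntegral ℤ (q * a) ∧ IsIntegral ℤ (q * b) ∧ IsIntegral ℤ (q * c) := by
  have key : ∀ a : K, ∃ q : ℤ, q ≠ 0 ∧ IsIntegral ℤ (q * a) := by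
    intro a
    have : IsAlgebraic ℤ a :=
      (IsFractionRing.isAlgebraic_iff ℤ ℚ K).2 (Algebra.IsAlgebraic.isAlgebraic a)
    obtain ⟨q, hq, h⟩ := this.exists_integral_multiple
    exact ⟨q, hq, by simpa [zsmul_eq_mul] using h⟩
  obtain ⟨qa, ha, ha'⟩ := key a
  obtain ⟨qb, hb, hb'⟩ := key b
  obtain ⟨qc, hc, hc'⟩ := key c
  have hI : ∀ z : ℤ, IsIntegral ℤ (z : K) := fun z => isIntegral_algebraMap (R := ℤ) (A := K)
  refine ⟨qa * qb * qc, by positivity, ?_, ?_, ?_⟩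
  · have := ((hI qb).mul (hI qc)).mul ha'
    refine (congrArg (IsIntegral ℤ) ?_).mpr this; push_cast; ring
  · have := ((hI qa).mul (hI qc)).mul hb'
    refine (congrArg (IsIntegral ℤ) ?_).mpr this; push_cast; ring
  · have := ((hI qa).mul (hI qb)).mul hc'
    refine (congrArg (IsIntegral ℤ) ?_).mpr this; push_cast; ring

/-- the basic inequality -/
lemma basic {K : Type*} [Field K] [NumberField K] (ι : K →+* ℝ) (a b θ : K) (w : ℝ) (hw : w ≠ 0)
    (hb : ι b = Real.exp w) (ha : ι a = Real.exp (w * ι θ)) (hθ : Irrational (ι θ)) :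
    ∃ C : ℝ, 1 ≤ C ∧ ∀ N : ℕ, 2 ≤ N →
    (3 : ℝ) ^ (∑ l ∈ range (N ^ 4), l) ≤
      (((C * N ^ 2) ^ (2 * N ^ 3)) ^ (N ^ 4)) ^ (Module.finrank ℚ K) := by
  obtain ⟨q, hq0, hqa, hqb, hqθ⟩ := exists_den a b θ
  have hI : ∀ z : ℤ, IsIntegral ℤ (z : K) := fun z => isIntegral_algebraMap (R := ℤ) (A := K)
  have hIn : ∀ z : ℕ, IsIntegral ℤ (z : K) := fun z => by simpa using hI z
  obtain ⟨h, hh1, hha, hhb, hhθ⟩ : ∃ h : ℝ, 1 ≤ h ∧ (∀ τ : K →+* ℂ, ‖τ a‖ ≤ h) ∧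
      (∀ τ : K →+* ℂ, ‖τ b‖ ≤ h) ∧ (∀ τ : K →+* ℂ, 1 + ‖τ θ‖ ≤ h) := by
    have h1 := NumberField.house_nonneg a
    have h2 := NumberField.house_nonneg b
    have h3 := NumberField.house_nonneg θ
    refine ⟨1 + NumberField.house a + NumberField.house b + NumberField.house θ, by linarith,
      fun τ => ?_, fun τ => ?_, fun τ => ?_⟩
    · linarith [NumberField.norm_embedding_le_house a τ]
    · linarith [NumberField.norm_embedding_le_house b τ]
    · linarith [NumberField.norm_embedding_le_house θ τ]
  obtain ⟨p, hp⟩ : ∃ p : ℝ, p = |(q : ℝ)| := ⟨_, rfl⟩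
  have hp1 : 1 ≤ p := by rw [hp]; exact_mod_cast Int.one_le_abs hq0
  obtain ⟨t, ht⟩ : ∃ t : ℝ, t = 1 + |ι θ| := ⟨_, rfl⟩
  have ht1 : 1 ≤ t := by rw [ht]; linarith [abs_nonneg (ι θ)]
  have hC1 : 1 ≤ p ^ 3 * h ^ 3 := by
    have := one_le_pow₀ hp1 (n := 3)
    have := one_le_pow₀ hh1 (n := 3)
    nlinarith
  obtain ⟨C, hC⟩ : ∃ C : ℝ, C = p ^ 3 * h ^ 3 + p ^ 3 * (13 * t) * Real.exp (13 * |w| * t) :=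
    ⟨_, rfl⟩
  have hCa : p ^ 3 * h ^ 3 ≤ C := by
    rw [hC]; linarith [show 0 ≤ p ^ 3 * (13 * t) * Real.exp (13 * |w| * t) by positivity]
  have hCb : p ^ 3 * (13 * t) * Real.exp (13 * |w| * t) ≤ C := by
    rw [hC]; linarith
  have hC1' : 1 ≤ C := hC1.trans hCa
  refine ⟨C, hC1', fun N hN => ?_⟩
  have hN1 : (1 : ℝ) ≤ N := by exact_mod_cast (by omega : 1 ≤ N)
  have hN2 : (1 : ℝ) ≤ (N : ℝ) ^ 2 := one_le_pow₀ hN1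
  obtain ⟨Q, hQ⟩ : ∃ Q : ℝ, Q = C * N ^ 2 := ⟨_, rfl⟩
  have hQN : (N : ℝ) ^ 2 ≤ Q := by rw [hQ]; nlinarith
  have hQ1 : 1 ≤ Q := hN2.trans hQN
  rw [← hQ]
  obtain ⟨L, hL⟩ : ∃ L : ℕ, L = N ^ 4 := ⟨_, rfl⟩
  rw [← hL]
  let e : Fin L ≃ Fin (N ^ 3) × Fin N :=
    Fintype.equivOfCardEq (by simp [hL, pow_succ])
  let g : Fin L ≃ Fin (N ^ 2) × Fin (N ^ 2) :=
    Fintype.equivOfCardEq (by simp [hL]; ring)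
  let x : Fin L → K := fun k => ((g k).1 : ℕ) + ((g k).2 : ℕ) * θ
  let M : Matrix (Fin L) (Fin L) K := Matrix.of fun i k =>
    (q : K) ^ (3 * N ^ 3) * (x k ^ ((e i).1 : ℕ) *
      (b ^ ((g k).1 : ℕ) * a ^ ((g k).2 : ℕ)) ^ ((e i).2 : ℕ))
  -- exponent bounds
  have he1 : ∀ i, ((e i).1 : ℕ) ≤ N ^ 3 := fun i => (e i).1.2.le
  have hgj1 : ∀ i k, ((g k).1 : ℕ) * ((e i).2 : ℕ) ≤ N ^ 3 := fun i k =>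
    (Nat.mul_le_mul (g k).1.2.le (e i).2.2.le).trans (by rw [← pow_succ])
  have hgj2 : ∀ i k, ((g k).2 : ℕ) * ((e i).2 : ℕ) ≤ N ^ 3 := fun i k =>
    (Nat.mul_le_mul (g k).2.2.le (e i).2.2.le).trans (by rw [← pow_succ])
  have hint : ∀ i k, IsIntegral ℤ (M i k) := by
    intro i k
    have h1 := he1 i
    have h2 := hgj1 i k
    have h3 := hgj2 i k
    obtain ⟨r, hr⟩ : ∃ r, 3 * N ^ 3 = ((e i).1 : ℕ) + ((g k).1 : ℕ) * ((e i).2 : ℕ) +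
      ((g k).2 : ℕ) * ((e i).2 : ℕ) + r := Nat.exists_eq_add_of_le (by omega)
    have hx : IsIntegral ℤ (q * x k) := by
      have := ((hI q).mul (hIn (g k).1)).add ((hIn (g k).2).mul hqθ)
      refine (congrArg (IsIntegral ℤ) ?_).mpr this; simp only [x]; ring
    have := (((hI q).pow r).mul (hx.pow ((e i).1 : ℕ))).mul
      ((hqb.pow (((g k).1 : ℕ) * ((e i).2 : ℕ))).mul (hqa.pow (((g k).2 : ℕ) * ((e i).2 : ℕ))))
    refine (congrArg (IsIntegral ℤ) ?_).mpr this
    simp only [M, Matrix.of_apply, hr]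
    simp only [mul_pow, pow_add, pow_mul]
    ring
  have hH : ∀ (τ : K →+* ℂ) i k, ‖τ (M i k)‖ ≤ Q ^ (N ^ 3) := by
    intro τ i k
    have hx : ‖τ (x k)‖ ≤ N ^ 2 * h := by
      simp only [x, map_add, map_mul, map_natCast]
      refine (norm_add_le _ _).trans ?_
      rw [norm_mul, Complex.norm_natCast, Complex.norm_natCast]
      have h1 : (((g k).1 : ℕ) : ℝ) ≤ N ^ 2 := by exact_mod_cast (g k).1.2.le
      have h2 : (((g k).2 : ℕ) : ℝ) ≤ N ^ 2 := by exact_mod_cast (g k).2.2.le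
      calc _ ≤ (N : ℝ) ^ 2 + N ^ 2 * ‖τ θ‖ := by gcongr
        _ = N ^ 2 * (1 + ‖τ θ‖) := by ring
        _ ≤ _ := by gcongr; exact hhθ τ
    have hNh : 1 ≤ N ^ 2 * h := by nlinarith
    simp only [M, Matrix.of_apply, mul_pow, map_mul, map_pow, map_intCast, norm_mul, norm_pow,
      Complex.norm_intCast, ← pow_mul]
    rw [← hp]
    calc _ ≤ p ^ (3 * N ^ 3) * ((N ^ 2 * h) ^ (N ^ 3) * (h ^ (N ^ 3) * h ^ (N ^ 3))) := by
          gcongr ?_ * (?_ * (?_ * ?_))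
          · exact (pow_le_pow_left₀ (norm_nonneg _) hx _).trans (pow_le_pow_right₀ hNh (he1 i))
          · exact (pow_le_pow_left₀ (norm_nonneg _) (hhb τ) _).trans
              (pow_le_pow_right₀ hh1 (hgj1 i k))
          · exact (pow_le_pow_left₀ (norm_nonneg _) (hha τ) _).trans
              (pow_le_pow_right₀ hh1 (hgj2 i k))
      _ = (p ^ 3 * h ^ 3 * N ^ 2) ^ (N ^ 3) := by
          rw [pow_mul, ← mul_pow, ← mul_pow, ← mul_pow]; ring
      _ ≤ _ := by rw [hQ]; gcongr
  -- values
  have hval : ∀ i k, ι (M i k) = (q : ℝ) ^ (3 * N ^ 3) *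
      (ι (x k) ^ ((e i).1 : ℕ) * Real.exp ((w * ((e i).2 : ℕ)) * ι (x k))) := by
    intro i k
    simp only [M, Matrix.of_apply, map_mul, map_pow, map_intCast, hb, ha]
    congr 2
    rw [← Real.exp_nat_mul, ← Real.exp_nat_mul, ← Real.exp_add, ← Real.exp_nat_mul]
    congr 1
    simp only [x, map_add, map_mul, map_natCast]
    ring
  have hxinj : Function.Injective fun k => ι (x k) := by
    intro k l hkl
    simp only [x, map_add, map_mul, map_natCast] at hkl
    apply g.injective
    have h2 : ((g k).2 : ℕ) = (g l).2 := by
      by_contra hne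
      apply hθ
      have hne' : (((g k).2 : ℕ) : ℝ) - ((g l).2 : ℕ) ≠ 0 :=
        sub_ne_zero.2 (by exact_mod_cast hne)
      refine ⟨(((g l).1 : ℕ) - ((g k).1 : ℕ)) / (((g k).2 : ℕ) - ((g l).2 : ℕ)), ?_⟩
      push_cast
      rw [div_eq_iff hne']
      linarith
    have h1 : ((g k).1 : ℕ) = (g l).1 := by
      rw [h2] at hkl
      exact_mod_cast add_right_cancel hkl
    exact Prod.ext (Fin.ext h1) (Fin.ext h2)
  have hdet : M.det ≠ 0 := by
    intro h0
    have hnv := nonvanish (fun j : Fin N => w * (j : ℕ))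
      (fun i j hij => Fin.ext (by exact_mod_cast mul_left_cancel₀ hw hij))
      (fun k => ι (x k)) hxinj e
    have h1 : ι M.det = 0 := by rw [h0, map_zero]
    rw [RingHom.map_det] at h1
    have h2 : ι.mapMatrix M = (q : ℝ) ^ (3 * N ^ 3) •
      (Matrix.of fun i k : Fin L => ι (x k) ^ ((e i).1 : ℕ) *
        Real.exp ((w * ((e i).2 : ℕ)) * ι (x k))) := by
      ext i k
      simp only [RingHom.mapMatrix_apply, Matrix.map_apply, Matrix.smul_apply, smul_eq_mul, hval,
        Matrix.of_apply]
    rw [h2, Matrix.det_smul] at h1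
    refine hnv ((mul_eq_zero.1 h1).resolve_left ?_)
    have : (q : ℝ) ≠ 0 := by exact_mod_cast hq0
    positivity
  -- upper bound
  let σ : K →+* ℂ := Complex.ofRealHom.comp ι
  have hl := liouville σ M hint hdet (Q ^ (N ^ 3)) hH
  let f : Fin L → ℂ → ℂ := fun i z => (q : ℂ) ^ (3 * N ^ 3) *
      (z ^ ((e i).1 : ℕ) * Complex.exp (((w * ((e i).2 : ℕ) : ℝ) : ℂ) * z))
  let ζ : ℕ → ℂ := fun k => if hk : k < L then ((ι (x ⟨k, hk⟩) : ℝ) : ℂ) else 0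
  have hr0 : 0 < (N : ℝ) ^ 2 * t := by positivity
  have hu := det_upper f (by intro i; simp only [f]; fun_prop) ζ (N ^ 2 * t) (Q ^ (N ^ 3)) hr0
    (by
      intro k
      by_cases hk : k < L
      · simp only [ζ, hk, dif_pos, Complex.norm_real, Real.norm_eq_abs]
        simp only [x, map_add, map_mul, map_natCast]
        refine (abs_add_le _ _).trans ?_
        rw [abs_mul, Nat.abs_cast, Nat.abs_cast]
        have h1 : (((g ⟨k, hk⟩).1 : ℕ) : ℝ) ≤ N ^ 2 := by exact_mod_cast (g ⟨k, hk⟩).1.2.le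
        have h2 : (((g ⟨k, hk⟩).2 : ℕ) : ℝ) ≤ N ^ 2 := by exact_mod_cast (g ⟨k, hk⟩).2.2.le
        calc _ ≤ (N : ℝ) ^ 2 + N ^ 2 * |ι θ| := by gcongr
          _ = N ^ 2 * t := by rw [ht]; ring
      · simp only [ζ, hk, dif_neg, not_false_eq_true, norm_zero]
        exact hr0.le)
    (by
      intro i z hz
      have hj : (((e i).2 : ℕ) : ℝ) ≤ N := by exact_mod_cast (e i).2.2.le
      have hbase : 1 ≤ 13 * (N ^ 2 * t) := by nlinarith
      simp only [f, norm_mul, norm_pow, Complex.norm_intCast, ← hp]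
      calc _ ≤ p ^ (3 * N ^ 3) * ((13 * (N ^ 2 * t)) ^ (N ^ 3) *
              Real.exp (13 * |w| * t) ^ (N ^ 3)) := by
            gcongr ?_ * (?_ * ?_)
            · exact (pow_le_pow_left₀ (norm_nonneg _) hz _).trans
                (pow_le_pow_right₀ hbase (he1 i))
            · rw [← Real.exp_nat_mul]
              refine (Complex.norm_exp_le_exp_norm _).trans (Real.exp_le_exp.2 ?_)
              rw [norm_mul, Complex.norm_real, Real.norm_eq_abs, abs_mul, Nat.abs_cast]
              calc _ ≤ |w| * N * (13 * (N ^ 2 * t)) := by gcongr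
                _ = _ := by push_cast; ring
        _ = (p ^ 3 * (13 * t) * Real.exp (13 * |w| * t) * N ^ 2) ^ (N ^ 3) := by
            rw [pow_mul, ← mul_pow, ← mul_pow]; ring
        _ ≤ _ := by rw [hQ]; gcongr)
  have hσ : σ M.det = (Matrix.of fun i k : Fin L => f i (ζ k)).det := by
    rw [RingHom.map_det]
    congr 1
    ext i k
    simp only [RingHom.mapMatrix_apply, Matrix.map_apply, Matrix.of_apply, σ, RingHom.comp_apply,
      hval, f, ζ, Fin.is_lt, dif_pos, Fin.eta]
    simp
  rw [← hσ] at hu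
  have hfac : (L.factorial : ℝ) ≤ (Q ^ (N ^ 3)) ^ L := by
    calc (L.factorial : ℝ) ≤ (L : ℝ) ^ L := by exact_mod_cast Nat.factorial_le_pow L
      _ ≤ _ := by
        gcongr
        calc (L : ℝ) = (N ^ 2) ^ 2 := by rw [hL]; push_cast; ring
          _ ≤ Q ^ 2 := by gcongr
          _ ≤ Q ^ (N ^ 3) := pow_le_pow_right₀ hQ1
              (by calc 2 ≤ N := hN
                    _ ≤ N ^ 3 := Nat.le_self_pow (by norm_num) N)
  have hX : L.factorial * (Q ^ (N ^ 3)) ^ L ≤ (Q ^ (2 * N ^ 3)) ^ L := by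
    calc _ ≤ (Q ^ (N ^ 3)) ^ L * (Q ^ (N ^ 3)) ^ L := by gcongr
      _ = _ := by rw [← mul_pow, ← pow_add, two_mul]
  obtain ⟨s, hs⟩ : ∃ s, s = ∑ l ∈ range L, l := ⟨_, rfl⟩
  rw [← hs] at hu ⊢
  obtain ⟨Y, hY⟩ : ∃ Y : ℝ, Y = (Q ^ (2 * N ^ 3)) ^ L := ⟨_, rfl⟩
  rw [← hY] at hX ⊢
  have hY0 : 0 ≤ Y := by rw [hY]; positivity
  have hfin : 0 < Module.finrank ℚ K := Module.finrank_pos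
  have h1 : (1 : ℝ) ≤ Y * (1 / 3) ^ s * Y ^ (Module.finrank ℚ K - 1) := by
    refine hl.trans ?_
    gcongr
    refine hu.trans ?_
    rw [← mul_assoc]
    gcongr
  calc (3 : ℝ) ^ s = 3 ^ s * 1 := by ring
    _ ≤ 3 ^ s * (Y * (1 / 3) ^ s * Y ^ (Module.finrank ℚ K - 1)) := by gcongr
    _ = (3 * (1 / 3)) ^ s * (Y ^ (Module.finrank ℚ K - 1) * Y) := by rw [mul_pow]; ring
    _ = _ := by rw [pow_sub_one_mul hfin.ne']; norm_num

end GS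

/-- consequence of Gelfond–Schneider: if `α, β` are nonzero real algebraic
numbers with `|α|, |β| ≠ 1` such that `log|α|` and `log|β|` are linearly independent
over `ℚ`, then `log|α| / log|β|` is transcendental. -/
theorem ratio_of_logs_transcendental (α β : ℝ)
    (hα0 : α ≠ 0) (hβ0 : β ≠ 0)
    (hαalg : IsAlgebraic ℚ α) (hβalg : IsAlgebraic ℚ β)
    (hα1 : |α| ≠ 1) (hβ1 : |β| ≠ 1)
    (hind : LinearIndependent ℚ ![Real.log |α|, Real.log |β|]) :
    Transcendental ℚ (Real.log |α| / Real.log |β|) := by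
  intro hθ
  have hw : Real.log |β| ≠ 0 := by
    have := abs_pos.2 hβ0
    exact Real.log_ne_zero_of_pos_of_ne_one this hβ1
  have habs : ∀ z : ℝ, IsAlgebraic ℚ z → IsAlgebraic ℚ |z| := by
    intro z hz
    rcases abs_choice z with h | h <;> rw [h]
    · exact hz
    · exact hz.neg
  have ha := habs α hαalg
  have hb := habs β hβalg
  have hirr : Irrational (Real.log |α| / Real.log |β|) := by
    rintro ⟨u, hu⟩
    rw [LinearIndependent.pair_iff] at hind
    have h1 := hind 1 (-u) (by
      simp only [Rat.smul_def]
      push_cast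
      rw [hu]
      field_simp
      ring)
    exact one_ne_zero h1.1
  let K := IntermediateField.adjoin ℚ
    ({|α|, |β|, Real.log |α| / Real.log |β|} : Set ℝ)
  have : FiniteDimensional ℚ K := by
    apply IntermediateField.finiteDimensional_adjoin
    intro x hx
    simp only [Set.mem_insert_iff, Set.mem_singleton_iff] at hx
    rcases hx with rfl | rfl | rfl
    · exact ha.isIntegral
    · exact hb.isIntegral
    · exact hθ.isIntegral
  have : NumberField K := ⟨⟩
  have hmem : ∀ x ∈ ({|α|, |β|, Real.log |α| / Real.log |β|} : Set ℝ), x ∈ K :=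
    fun x hx => IntermediateField.subset_adjoin ℚ _ hx
  obtain ⟨C, hC, h⟩ := GS.basic (algebraMap K ℝ) ⟨|α|, hmem _ (by simp)⟩ ⟨|β|, hmem _ (by simp)⟩
    ⟨Real.log |α| / Real.log |β|, hmem _ (by simp)⟩ (Real.log |β|) hw
    (by
      change |β| = _
      rw [Real.exp_log (abs_pos.2 hβ0)])
    (by
      change |α| = Real.exp (Real.log |β| * (Real.log |α| / Real.log |β|))
      rw [mul_div_cancel₀ _ hw, Real.exp_log (abs_pos.2 hα0)])
    hirr
  exact GS.numeric C hC _ h
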